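/- The group homomorphism from the braid group Br₃ to SL(2,ℤ) × ℤ, whose first component sends σ₁ to the matrix [[1,1],[0,1]] and σ₂ to the matrix [[1,0],[-1,1]], and whose second component (the abelianization map of Br₃) sends both σ₁ and σ₂ to 1 ∈ ℤ, is injective. -/

import Mathlib

/-- The braid relation for the braid group on three strands, as a relation on the free group
on two generators: `σ₁σ₂σ₁(σ₂σ₁σ₂)⁻¹`. -/
def braidRels : Set (FreeGroup (Fin 2)) :=
  {FreeGroup.of 0 * FreeGroup.of 1 * FreeGroup.of 0 *
    (FreeGroup.of 1 * FreeGroup.of 0 * FreeGroup.of 1)⁻¹}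

/-- The braid group on three strands, `Br₃ = ⟨σ₁, σ₂ ∣ σ₁σ₂σ₁ = σ₂σ₁σ₂⟩`. -/
abbrev Br3 : Type := PresentedGroup braidRels

/-- The standard generators `σ₁`, `σ₂` of `Br₃`. -/
def σ (i : Fin 2) : Br3 := PresentedGroup.of i

/-- The matrix `A = [[1,1],[0,1]]` as an element of `SL(2,ℤ)`. -/
def Amat : Matrix.SpecialLinearGroup (Fin 2) ℤ :=
  ⟨!![1, 1; 0, 1], by norm_num [Matrix.det_fin_two_of]⟩

/-- The matrix `B = [[1,0],[-1,1]]` as an element of `SL(2,ℤ)`. -/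
def Bmat : Matrix.SpecialLinearGroup (Fin 2) ℤ :=
  ⟨!![1, 0; -1, 1], by norm_num [Matrix.det_fin_two_of]⟩

section TorusKnotGroup

variable {G : Type*} [Group G] {u d : G}

/-- If `u ^ 3 = d ^ 2`, then every element of the subgroup generated by `u` and `d` has the form
`u ^ a * w * d ^ b`, where `w` is a positive word in `d⁻¹ * u` and `d * u⁻¹`. -/
theorem exists_zpow_mul_mul_zpow_of_mem_closure (h : u ^ 3 = d ^ 2) {g : G}
    (hg : g ∈ Subgroup.closure {u, d}) :
    ∃ w ∈ Submonoid.closure {d⁻¹ * u, d * u⁻¹}, ∃ a b : ℤ, g = u ^ a * w * d ^ b := by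
  have hc : Commute u (d ^ 2) := h ▸ Commute.self_pow u 3
  have hu : ∀ g : G,
      (∃ w ∈ Submonoid.closure {d⁻¹ * u, d * u⁻¹}, ∃ a b : ℤ, g = u ^ a * w * d ^ b) →
      ∃ w ∈ Submonoid.closure {d⁻¹ * u, d * u⁻¹}, ∃ a b : ℤ, g * u = u ^ a * w * d ^ b := by
    rintro _ ⟨w, hw, a, b, rfl⟩
    have hx : d⁻¹ * u ∈ Submonoid.closure {d⁻¹ * u, d * u⁻¹} :=
      Submonoid.subset_closure (by simp)
    have hy : d * u⁻¹ ∈ Submonoid.closure {d⁻¹ * u, d * u⁻¹} :=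
      Submonoid.subset_closure (by simp)
    have hm (m : ℤ) : d ^ (2 * m) * u = u * d ^ (2 * m) := by
      have := (hc.zpow_right m).eq
      rw [zpow_mul]
      exact_mod_cast this.symm
    obtain ⟨m, rfl | rfl⟩ := Int.even_or_odd' b
    · induction hw using Submonoid.closure_induction_right with
      | one =>
        exact ⟨1, one_mem _, a + 1, 2 * m, by
          rw [mul_assoc, hm, zpow_add_one]; simp only [mul_one, mul_assoc]⟩
      | mul_right v hv z hz _ =>
        obtain rfl | rfl := hz
        · refine ⟨v * (d * u⁻¹), mul_mem hv hy, a, 2 * m, ?_⟩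
          have key : d⁻¹ * u * u = d * u⁻¹ := by
            have : u * u * u = d * d := by simpa only [pow_succ, pow_zero, one_mul] using h
            rw [eq_mul_inv_iff_mul_eq, mul_assoc, mul_assoc, inv_mul_eq_iff_eq_mul, ← mul_assoc,
              this]
          rw [mul_assoc, hm, ← key]
          simp only [mul_assoc]
        · refine ⟨v, hv, a, 2 * m + 1, ?_⟩
          rw [mul_assoc, hm, add_comm, zpow_one_add]
          group
    · refine ⟨w * (d⁻¹ * u), mul_mem hw hx, a, 2 * (m + 1), ?_⟩
      have e : d ^ (2 * m + 1) = d⁻¹ * d ^ (2 * (m + 1)) := by group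
      rw [e, mul_assoc, mul_assoc, mul_assoc, hm]
      simp only [mul_assoc]
  have hd : ∀ (n : ℤ) (g : G),
      (∃ w ∈ Submonoid.closure {d⁻¹ * u, d * u⁻¹}, ∃ a b : ℤ, g = u ^ a * w * d ^ b) →
      ∃ w ∈ Submonoid.closure {d⁻¹ * u, d * u⁻¹}, ∃ a b : ℤ, g * d ^ n = u ^ a * w * d ^ b := by
    rintro n _ ⟨w, hw, a, b, rfl⟩
    exact ⟨w, hw, a, b + n, by rw [zpow_add, mul_assoc]⟩
  induction hg using Subgroup.closure_induction_right with
  | one => exact ⟨1, one_mem _, 0, 0, by simp⟩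
  | mul_right g _ z hz ih =>
    obtain rfl | rfl := hz
    · exact hu g ih
    · simpa using hd 1 g ih
  | mul_inv_cancel g _ z hz ih =>
    obtain rfl | rfl := hz
    · have e : g * z⁻¹ = g * z * z * d ^ (-2 : ℤ) := by
        rw [eq_comm, zpow_neg, mul_inv_eq_iff_eq_mul]
        norm_cast
        rw [← h]
        simp only [pow_succ, pow_zero, one_mul, mul_assoc, inv_mul_cancel_left]
      rw [e]
      exact hd _ _ (hu _ (hu _ ih))
    · simpa using hd (-1) g ih

end TorusKnotGroup

/-- A positive word in `A⁻¹` and `B` is trivial or has positive diagonal entries and nonpositive,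
not both zero, off-diagonal entries. -/
theorem eq_one_or_sign_of_mem_closure {G : Type*} [Group G]
    (f : G →* Matrix.SpecialLinearGroup (Fin 2) ℤ) {x y : G} (hx : f x = Amat⁻¹) (hy : f y = Bmat)
    {w : G} (hw : w ∈ Submonoid.closure {x, y}) :
    w = 1 ∨ (0 < f w 0 0 ∧ 0 < f w 1 1 ∧ f w 0 1 ≤ 0 ∧ f w 1 0 ≤ 0 ∧ f w 0 1 + f w 1 0 < 0) := by
  induction hw using Submonoid.closure_induction_right with
  | one => exact Or.inl rfl
  | mul_right v _ z hz ih =>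
    right
    have hv : 0 < f v 0 0 ∧ 0 < f v 1 1 ∧ f v 0 1 ≤ 0 ∧ f v 1 0 ≤ 0 := by
      rcases ih with rfl | ih
      · simp
      · exact ⟨ih.1, ih.2.1, ih.2.2.1, ih.2.2.2.1⟩
    obtain rfl | rfl := hz
    · have hA : (Amat⁻¹ : Matrix.SpecialLinearGroup (Fin 2) ℤ).1 = !![1, -1; 0, 1] := by decide
      rw [map_mul, hx, Matrix.SpecialLinearGroup.coe_mul, hA]
      simp [Matrix.mul_apply, Fin.sum_univ_two]
      lia
    · have hB : Bmat.1 = !![1, 0; -1, 1] := rfl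
      rw [map_mul, hy, Matrix.SpecialLinearGroup.coe_mul, hB]
      simp [Matrix.mul_apply, Fin.sum_univ_two]
      lia

/-- No product of powers of `AB` and `ABA` has the sign pattern of a nontrivial positive word in
`A⁻¹` and `B`. -/
theorem not_sign_zpow_mul_zpow (a b : ℤ) :
    let M := (Amat * Bmat) ^ a * (Amat * Bmat * Amat) ^ b
    ¬ (0 < M 0 0 ∧ 0 < M 1 1 ∧ M 0 1 ≤ 0 ∧ M 1 0 ≤ 0 ∧ M 0 1 + M 1 0 < 0) := by
  have hU : (Amat * Bmat) ^ 6 = 1 := by decide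
  have hD : (Amat * Bmat * Amat) ^ 4 = 1 := by decide
  have finite : ∀ i : Fin 6, ∀ j : Fin 4,
      let M := (Amat * Bmat) ^ (i : ℕ) * (Amat * Bmat * Amat) ^ (j : ℕ)
      ¬ (0 < M 0 0 ∧ 0 < M 1 1 ∧ M 0 1 ≤ 0 ∧ M 1 0 ≤ 0 ∧ M 0 1 + M 1 0 < 0) := by
    decide
  obtain ⟨i, hi⟩ := Int.eq_ofNat_of_zero_le (Int.emod_nonneg a (by decide : (6 : ℤ) ≠ 0))
  obtain ⟨j, hj⟩ := Int.eq_ofNat_of_zero_le (Int.emod_nonneg b (by decide : (4 : ℤ) ≠ 0))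
  have ea : (Amat * Bmat) ^ a = (Amat * Bmat) ^ i := by
    rw [zpow_eq_zpow_emod' a hU, ← zpow_natCast, ← hi]; rfl
  have eb : (Amat * Bmat * Amat) ^ b = (Amat * Bmat * Amat) ^ j := by
    rw [zpow_eq_zpow_emod' b hD, ← zpow_natCast, ← hj]; rfl
  rw [ea, eb]
  exact finite ⟨i, by lia⟩ ⟨j, by lia⟩

theorem braid_relation : σ 0 * σ 1 * σ 0 = σ 1 * σ 0 * σ 1 :=
  mul_inv_eq_one.mp (PresentedGroup.one_of_mem (rels := braidRels) rfl)

theorem closure_braid_generators :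
    Subgroup.closure {σ 0 * σ 1, σ 0 * σ 1 * σ 0} = ⊤ := by
  set H := Subgroup.closure {σ 0 * σ 1, σ 0 * σ 1 * σ 0}
  have hu : σ 0 * σ 1 ∈ H := Subgroup.subset_closure (by simp)
  have hd : σ 0 * σ 1 * σ 0 ∈ H := Subgroup.subset_closure (by simp)
  have h0 : σ 0 ∈ H := (mul_mem_cancel_left hu).mp hd
  have h1 : σ 1 ∈ H := (mul_mem_cancel_left h0).mp hu
  rw [eq_top_iff, ← PresentedGroup.closure_range_of, Subgroup.closure_le]
  rintro _ ⟨i, rfl⟩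
  fin_cases i
  · exact h0
  · exact h1

/-- The group homomorphism `Br₃ → SL(2,ℤ) × ℤ` whose first component sends `σ₁ ↦ A`,
`σ₂ ↦ B` and whose second component (the abelianization of `Br₃`) sends both generators
to `1 ∈ ℤ` is injective. -/
theorem br3_to_SL2Z_times_Z_injective
    (φ : Br3 →* Matrix.SpecialLinearGroup (Fin 2) ℤ × Multiplicative ℤ)
    (h1 : φ (σ 0) = (Amat, Multiplicative.ofAdd 1))
    (h2 : φ (σ 1) = (Bmat, Multiplicative.ofAdd 1)) :
    Function.Injective φ := by
  have hr := braid_relation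
  set u := σ 0 * σ 1 with hu
  set d := u * σ 0 with hd
  have hcube : u ^ 3 = d ^ 2 := by
    calc
      u ^ 3 = u * σ 0 * (σ 1 * σ 0 * σ 1) := by
          simp only [hu, pow_succ, pow_zero, one_mul, mul_assoc]
      _ = d ^ 2 := by rw [← hr, sq]
  have hx : d⁻¹ * u = (σ 0)⁻¹ := by rw [hd]; group
  have hy : d * u⁻¹ = σ 1 := by rw [hr, hu]; group
  rw [injective_iff_map_eq_one]
  intro g hg
  obtain ⟨w, hw, a, b, rfl⟩ := exists_zpow_mul_mul_zpow_of_mem_closure hcube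
    (closure_braid_generators ▸ Subgroup.mem_top g)
  rw [hx, hy] at hw
  let f := (MonoidHom.fst _ _).comp φ
  have f0 : f (σ 0) = Amat := congrArg Prod.fst h1
  have f1 : f (σ 1) = Bmat := congrArg Prod.fst h2
  have fu : f u = Amat * Bmat := by rw [hu, map_mul, f0, f1]
  have fd : f d = Amat * Bmat * Amat := by rw [hd, map_mul, fu, f0]
  have hfg : f u ^ a * f w * f d ^ b = 1 := by
    rw [← map_zpow, ← map_zpow, ← map_mul, ← map_mul]
    exact congrArg Prod.fst hg
  have hfw : f w = (Amat * Bmat) ^ (-a) * (Amat * Bmat * Amat) ^ (-b) := by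
    rw [fu, fd] at hfg
    rw [zpow_neg, zpow_neg, eq_mul_inv_iff_mul_eq,
      eq_inv_of_mul_eq_one_right ((mul_assoc _ _ _).symm.trans hfg)]
  obtain rfl | hsign := eq_one_or_sign_of_mem_closure f (by rw [map_inv, f0]) f1 hw
  · let e := (MonoidHom.snd _ _).comp φ
    have e0 : e (σ 0) = Multiplicative.ofAdd 1 := congrArg Prod.snd h1
    have e1 : e (σ 1) = Multiplicative.ofAdd 1 := congrArg Prod.snd h2
    have heg : e (u ^ a * 1 * d ^ b) = 1 := congrArg Prod.snd hg
    have hab : 2 * a + 3 * b = 0 := by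
      simp only [hd, hu, map_mul, map_zpow, map_one, e0, e1] at heg
      simpa [← ofAdd_add, ← ofAdd_zsmul] using congrArg Multiplicative.toAdd heg
    obtain ⟨m, rfl⟩ : ∃ m, a = 3 * m := ⟨a / 3, by lia⟩
    obtain rfl : b = 2 * -m := by lia
    rw [zpow_mul, zpow_mul, mul_one]
    norm_cast
    rw [hcube, zpow_neg, mul_inv_cancel]
  · rw [hfw] at hsign
    exact absurd hsign (not_sign_zpow_mul_zpow _ _)
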